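/- Suppose (n, p) = (3, 2) and k ≥ 4 is an integer, or (n, p) = (5, 4) and k ≥ 6 is an integer. Let λ = √(k(k+n−1)/p) and φ₀ = √((p − n/λ²)/(n−p)). Let t ∈ [b₀, b₂] ↦ (φ(t), ψ(t)) be a continuously differentiable solution of (ODE2) and let b₁ ∈ (b₀, b₂) be such that φ(b₀) ≥ √((3p−n−1)/(3(n−p))), ψ(b₀) = ψ(b₁) = ψ(b₂) = 0, ψ(t) > 0 for t ∈ (b₀, b₁), and ψ(t) < 0 for t ∈ (b₁, b₂). Then φ(b₁) > φ₀ and φ(b₀) < φ(b₂) < φ₀. In particular, the system (ODE2) has no limit cycle contained in the region φ ≥ √((3p−n−1)/(3(n−p))). -/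

import Mathlib

/-- `f₁(φ) = (λ²-1)p/(1+λ²φ²) - (n-p)`. -/
noncomputable def f1 (n p : ℕ) (lam φ : ℝ) : ℝ :=
  (lam ^ 2 - 1) * p / (1 + lam ^ 2 * φ ^ 2) - ((n : ℝ) - p)

/-- `f₂(φ) = (n-p) + p/(1+λ²φ²)`. -/
noncomputable def f2 (n p : ℕ) (lam φ : ℝ) : ℝ :=
  ((n : ℝ) - p) + (p : ℝ) / (1 + lam ^ 2 * φ ^ 2)

/-- Second component of the vector field of the autonomous system (ODE2). -/
noncomputable def X2 (n p : ℕ) (lam φ ψ : ℝ) : ℝ :=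
  -ψ - (f2 n p lam φ * ψ - f1 n p lam φ * φ) * (1 + (φ + ψ) ^ 2)

/-- The integrating factor which removes the term quadratic in `ψ` from (ODE2). -/
noncomputable def intFactor (p : ℕ) (lam x : ℝ) : ℝ :=
  Real.exp (3 * x ^ 2 + p * (3 - lam ^ 2) / lam ^ 2 * Real.log (1 + lam ^ 2 * x ^ 2))

/-- The derivative of the potential of the conservative part of (ODE2). -/
noncomputable def force (n p : ℕ) (lam x : ℝ) : ℝ :=
  intFactor p lam x * (f1 n p lam x * x * (1 + x ^ 2))

/-- The potential of the conservative part of (ODE2). -/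
noncomputable def potential (n p : ℕ) (lam x : ℝ) : ℝ :=
  ∫ u in (0 : ℝ)..x, force n p lam u

/-- A Lyapunov function of (ODE2) in the region of positive linear damping. -/
noncomputable def energy (n p : ℕ) (lam x y : ℝ) : ℝ :=
  intFactor p lam x * y ^ 2 / 2 - potential n p lam x

/-- The rate of decay of `energy` along solutions of (ODE2). -/
noncomputable def dissipation (n p : ℕ) (lam x y : ℝ) : ℝ :=
  intFactor p lam x *
    ((1 + f2 n p lam x * (1 + x ^ 2) - 2 * f1 n p lam x * x ^ 2) * y ^ 2 + f2 n p lam x * y ^ 4)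

lemma one_add_sq_mul_sq_pos (lam x : ℝ) : 0 < 1 + lam ^ 2 * x ^ 2 := by positivity

lemma intFactor_pos (p : ℕ) (lam x : ℝ) : 0 < intFactor p lam x := Real.exp_pos _

lemma hasDerivAt_intFactor {n p : ℕ} {lam : ℝ} (hnp : (n : ℝ) = p + 1) (hlam : lam ≠ 0) (x : ℝ) :
    HasDerivAt (intFactor p lam)
      (intFactor p lam x * (2 * x * (2 * f2 n p lam x - f1 n p lam x))) x := by
  have hx := (one_add_sq_mul_sq_pos lam x).ne'
  have h2 : HasDerivAt (fun x : ℝ => x ^ 2) (2 * x) x := by simpa using hasDerivAt_pow 2 x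
  have hlog := ((h2.const_mul (lam ^ 2)).const_add 1).log hx
  have := ((h2.const_mul 3).add (hlog.const_mul (p * (3 - lam ^ 2) / lam ^ 2))).exp
  refine this.congr_deriv ?_
  simp only [intFactor, f1, f2, hnp]
  simp only [Pi.add_apply]
  congr 1
  field_simp
  ring

lemma continuous_force (n p : ℕ) (lam : ℝ) : Continuous (force n p lam) := by
  unfold force intFactor f1
  have h (x : ℝ) := (one_add_sq_mul_sq_pos lam x).ne'
  fun_prop (disch := exact h _)

lemma hasDerivAt_potential (n p : ℕ) (lam x : ℝ) :
    HasDerivAt (potential n p lam) (force n p lam x) x :=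
  intervalIntegral.integral_hasDerivAt_right ((continuous_force n p lam).intervalIntegrable _ _)
    (continuous_force n p lam).stronglyMeasurable.stronglyMeasurableAtFilter
    (continuous_force n p lam).continuousAt

lemma f1_mul_eq {n p : ℕ} {lam : ℝ} (hnp : (n : ℝ) = p + 1) (hlam : lam ≠ 0) (x : ℝ) :
    f1 n p lam x * (1 + lam ^ 2 * x ^ 2) = lam ^ 2 * ((p - n / lam ^ 2) - x ^ 2) := by
  have hx := (one_add_sq_mul_sq_pos lam x).ne'
  rw [f1, hnp]
  field_simp
  ring

lemma f1_pos {n p : ℕ} {lam x : ℝ} (hnp : (n : ℝ) = p + 1) (hlam : lam ≠ 0)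
    (hx : x ^ 2 < p - n / lam ^ 2) : 0 < f1 n p lam x := by
  refine pos_of_mul_pos_left ?_ (one_add_sq_mul_sq_pos lam x).le
  rw [f1_mul_eq hnp hlam]
  have := sub_pos.2 hx
  positivity

lemma f1_neg {n p : ℕ} {lam x : ℝ} (hnp : (n : ℝ) = p + 1) (hlam : lam ≠ 0)
    (hx : p - n / lam ^ 2 < x ^ 2) : f1 n p lam x < 0 := by
  refine neg_of_mul_neg_left ?_ (one_add_sq_mul_sq_pos lam x).le
  rw [f1_mul_eq hnp hlam]
  exact mul_neg_of_pos_of_neg (by positivity) (sub_neg.2 hx)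

lemma f1_eq_zero {n p : ℕ} {lam x : ℝ} (hnp : (n : ℝ) = p + 1) (hlam : lam ≠ 0)
    (hx : x ^ 2 = p - n / lam ^ 2) : f1 n p lam x = 0 := by
  have h := f1_mul_eq hnp hlam x
  rw [hx, sub_self, mul_zero, ← hx] at h
  exact (mul_eq_zero.1 h).resolve_right (one_add_sq_mul_sq_pos lam x).ne'

lemma f2_pos {n p : ℕ} {lam : ℝ} (hnp : (n : ℝ) = p + 1) (x : ℝ) : 0 < f2 n p lam x := by
  have := one_add_sq_mul_sq_pos lam x
  rw [f2, hnp, add_sub_cancel_left]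
  positivity

lemma damping_pos {n p : ℕ} {lam x : ℝ} (hnp : (n : ℝ) = p + 1) (hp : 0 < p)
    (hx : 2 * ((p : ℝ) - 1) ≤ 3 * x ^ 2) :
    0 < 1 + f2 n p lam x * (1 + x ^ 2) - 2 * f1 n p lam x * x ^ 2 := by
  have h := one_add_sq_mul_sq_pos lam x
  have hp' : (0 : ℝ) < p := by exact_mod_cast hp
  have : 1 + f2 n p lam x * (1 + x ^ 2) - 2 * f1 n p lam x * x ^ 2
      = (3 * x ^ 2 - 2 * ((p : ℝ) - 1)) + p * (3 + 3 * x ^ 2) / (1 + lam ^ 2 * x ^ 2) := by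
    rw [f1, f2, hnp]
    field_simp
    ring
  rw [this]
  have h1 := sub_nonneg.2 hx
  positivity

lemma dissipation_nonneg {n p : ℕ} {lam x : ℝ} (hnp : (n : ℝ) = p + 1) (hp : 0 < p)
    (hx : 2 * ((p : ℝ) - 1) ≤ 3 * x ^ 2) (y : ℝ) : 0 ≤ dissipation n p lam x y := by
  have h1 := damping_pos (lam := lam) hnp hp hx
  have h2 := f2_pos (lam := lam) hnp x
  have h3 := intFactor_pos p lam x
  unfold dissipation
  positivity

lemma dissipation_pos {n p : ℕ} {lam x y : ℝ} (hnp : (n : ℝ) = p + 1) (hp : 0 < p)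
    (hx : 2 * ((p : ℝ) - 1) ≤ 3 * x ^ 2) (hy : y ≠ 0) : 0 < dissipation n p lam x y := by
  have h1 := damping_pos (lam := lam) hnp hp hx
  have h2 := f2_pos (lam := lam) hnp x
  have h3 := intFactor_pos p lam x
  unfold dissipation
  positivity

lemma hasDerivAt_energy {n p : ℕ} {lam t : ℝ} {φ ψ : ℝ → ℝ} (hnp : (n : ℝ) = p + 1)
    (hlam : lam ≠ 0) (hφ : HasDerivAt φ (ψ t) t)
    (hψ : HasDerivAt ψ (X2 n p lam (φ t) (ψ t)) t) :
    HasDerivAt (fun t => energy n p lam (φ t) (ψ t)) (-dissipation n p lam (φ t) (ψ t)) t := by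
  have hμ := (hasDerivAt_intFactor hnp hlam (φ t)).comp t hφ
  have hV := (hasDerivAt_potential n p lam (φ t)).comp t hφ
  refine (((hμ.mul (hψ.pow 2)).div_const 2).sub hV).congr_deriv ?_
  simp only [dissipation, force, X2, Function.comp_apply, Pi.pow_apply]
  ring

lemma continuousOn_energy {n p : ℕ} {lam : ℝ} {φ ψ : ℝ → ℝ} {s : Set ℝ} (hnp : (n : ℝ) = p + 1)
    (hlam : lam ≠ 0) (hφ : ContinuousOn φ s) (hψ : ContinuousOn ψ s) :
    ContinuousOn (fun t => energy n p lam (φ t) (ψ t)) s := by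
  have hμ : Continuous (intFactor p lam) :=
    continuous_iff_continuousAt.2 fun x => (hasDerivAt_intFactor hnp hlam x).continuousAt
  have hV : Continuous (potential n p lam) :=
    continuous_iff_continuousAt.2 fun x => (hasDerivAt_potential n p lam x).continuousAt
  exact (((hμ.comp_continuousOn hφ).mul (hψ.pow 2)).div_const 2).sub (hV.comp_continuousOn hφ)

lemma energy_lt_of_ne_zero {n p : ℕ} {lam a b : ℝ} {φ ψ : ℝ → ℝ} (hnp : (n : ℝ) = p + 1)
    (hp : 0 < p) (hlam : lam ≠ 0) (hab : a < b)
    (hφ : ContinuousOn φ (Set.Icc a b)) (hψ : ContinuousOn ψ (Set.Icc a b))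
    (hsol : ∀ t ∈ Set.Ioo a b, HasDerivAt φ (ψ t) t ∧ HasDerivAt ψ (X2 n p lam (φ t) (ψ t)) t)
    (hreg : ∀ t ∈ Set.Ioo a b, 2 * ((p : ℝ) - 1) ≤ 3 * φ t ^ 2)
    (hne : ∀ t ∈ Set.Ioo a b, ψ t ≠ 0) :
    energy n p lam (φ b) (ψ b) < energy n p lam (φ a) (ψ a) := by
  refine strictAntiOn_of_deriv_neg (convex_Icc a b) (continuousOn_energy hnp hlam hφ hψ) ?_
    (Set.left_mem_Icc.2 hab.le) (Set.right_mem_Icc.2 hab.le) hab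
  intro t ht
  rw [interior_Icc] at ht
  rw [(hasDerivAt_energy hnp hlam (hsol t ht).1 (hsol t ht).2).deriv, neg_lt_zero]
  exact dissipation_pos hnp hp (hreg t ht) (hne t ht)

lemma energy_zero_right (n p : ℕ) (lam x : ℝ) :
    energy n p lam x 0 = -potential n p lam x := by
  simp [energy]

lemma neg_potential_le_energy (n p : ℕ) (lam x y : ℝ) :
    -potential n p lam x ≤ energy n p lam x y := by
  have := intFactor_pos p lam x
  have : 0 ≤ intFactor p lam x * y ^ 2 / 2 := by positivity
  unfold energy
  linarith

lemma strictMonoOn_potential {n p : ℕ} {lam : ℝ} (hnp : (n : ℝ) = p + 1) (hlam : lam ≠ 0) :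
    StrictMonoOn (potential n p lam) (Set.Icc 0 (Real.sqrt (p - n / lam ^ 2))) := by
  refine strictMonoOn_of_deriv_pos (convex_Icc _ _)
    (fun x _ => (hasDerivAt_potential n p lam x).continuousAt.continuousWithinAt) ?_
  intro x hx
  rw [interior_Icc] at hx
  rw [(hasDerivAt_potential n p lam x).deriv]
  have h0 := hx.1
  have h1 := f1_pos hnp hlam ((Real.lt_sqrt hx.1.le).1 hx.2)
  have h2 := intFactor_pos p lam x
  unfold force
  positivity

lemma strictAntiOn_potential {n p : ℕ} {lam : ℝ} (hnp : (n : ℝ) = p + 1) (hlam : lam ≠ 0) :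
    StrictAntiOn (potential n p lam) (Set.Ici (Real.sqrt (p - n / lam ^ 2))) := by
  refine strictAntiOn_of_deriv_neg (convex_Ici _)
    (fun x _ => (hasDerivAt_potential n p lam x).continuousAt.continuousWithinAt) ?_
  intro x hx
  rw [interior_Ici, Set.mem_Ioi] at hx
  rw [(hasDerivAt_potential n p lam x).deriv]
  have h0 : 0 < x := (Real.sqrt_nonneg _).trans_lt hx
  have h1 := f1_neg hnp hlam ((Real.sqrt_lt' h0).1 hx)
  exact mul_neg_of_pos_of_neg (intFactor_pos p lam x)
    (mul_neg_of_neg_of_pos (mul_neg_of_neg_of_pos h1 h0) (by positivity))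

lemma eq_of_periodic_of_antitone {f : ℝ → ℝ} {c : ℝ} (hc : 0 < c) (hf : Antitone f)
    (hper : Function.Periodic f c) (s t : ℝ) : f s = f t := by
  have key (s t : ℝ) : f s ≤ f t := by
    obtain ⟨m, hm⟩ := exists_nat_gt ((t - s) / c)
    rw [div_lt_iff₀ hc] at hm
    rw [← hper.nat_mul m s]
    exact hf (by linarith)
  exact le_antisymm (key s t) (key t s)

lemma eq_of_periodic_of_damping {n p : ℕ} {lam c : ℝ} {φ ψ : ℝ → ℝ} (hnp : (n : ℝ) = p + 1)
    (hp : 0 < p) (hlam : lam ≠ 0)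
    (hsol : ∀ t, HasDerivAt φ (ψ t) t ∧ HasDerivAt ψ (X2 n p lam (φ t) (ψ t)) t)
    (hreg : ∀ t, 2 * ((p : ℝ) - 1) ≤ 3 * φ t ^ 2) (hc : 0 < c)
    (hper : ∀ t, φ (t + c) = φ t ∧ ψ (t + c) = ψ t) (s t : ℝ) : φ s = φ t ∧ ψ s = ψ t := by
  have hE (t : ℝ) := hasDerivAt_energy hnp hlam (hsol t).1 (hsol t).2
  have hanti : Antitone fun t => energy n p lam (φ t) (ψ t) :=
    antitone_of_deriv_nonpos (fun t => (hE t).differentiableAt) fun t => by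
      rw [(hE t).deriv, neg_nonpos]
      exact dissipation_nonneg hnp hp (hreg t) _
  have hconst := eq_of_periodic_of_antitone hc hanti fun t => by
    simp only [(hper t).1, (hper t).2]
  have hzero (t : ℝ) : ψ t = 0 := by
    by_contra hne
    have h0 : HasDerivAt (fun t => energy n p lam (φ t) (ψ t)) 0 t :=
      (hasDerivAt_const t (energy n p lam (φ t) (ψ t))).congr_of_eventuallyEq
        (Filter.Eventually.of_forall fun s => hconst s t)
    have := (hE t).unique h0
    linarith [dissipation_pos (lam := lam) hnp hp (hreg t) hne]
  refine ⟨is_const_of_deriv_eq_zero (fun t => (hsol t).1.differentiableAt) (fun t => ?_) s t, ?_⟩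
  · rw [(hsol t).1.deriv, hzero t]
  · rw [hzero, hzero]

lemma contDiff_vectorField (n p : ℕ) (lam : ℝ) :
    ContDiff ℝ 1 fun z : ℝ × ℝ => (z.2, X2 n p lam z.1 z.2) := by
  unfold X2 f1 f2
  have h (x : ℝ) := (one_add_sq_mul_sq_pos lam x).ne'
  fun_prop (disch := exact fun _ => h _)

/-- A solution of (ODE2) reaching an equilibrium `(x, 0)` is at rest just before. -/
lemma exists_eq_zero_of_equilibrium {n p : ℕ} {lam a b : ℝ} {φ ψ : ℝ → ℝ} (hab : a < b)
    (hsol : ∀ t ∈ Set.Icc a b, HasDerivWithinAt φ (ψ t) (Set.Icc a b) t ∧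
      HasDerivWithinAt ψ (X2 n p lam (φ t) (ψ t)) (Set.Icc a b) t)
    (hψ : ψ b = 0) (heq : X2 n p lam (φ b) 0 = 0) :
    ∃ t, a < t ∧ t < b ∧ ψ t = 0 := by
  set Φ : ℝ → ℝ × ℝ := fun t => (φ t, ψ t)
  set v : ℝ × ℝ → ℝ × ℝ := fun z => (z.2, X2 n p lam z.1 z.2)
  have hΦ : ∀ t ∈ Set.Icc a b, HasDerivWithinAt Φ (v (Φ t)) (Set.Icc a b) t :=
    fun t ht => (hsol t ht).1.prodMk (hsol t ht).2
  obtain ⟨K, U, hU, hK⟩ :=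
    (contDiff_vectorField n p lam).contDiffAt.exists_lipschitzOnWith (x := Φ b)
  have hcont : ContinuousOn Φ (Set.Icc a b) := fun t ht => (hΦ t ht).continuousWithinAt
  have hlim : Filter.Tendsto Φ (nhdsWithin b (Set.Iic b)) (nhds (Φ b)) :=
    (hcont b (Set.right_mem_Icc.2 hab.le)).mono_of_mem_nhdsWithin
      (Icc_mem_nhdsLE_of_mem ⟨hab, le_rfl⟩)
  obtain ⟨l, hl, hlU⟩ := mem_nhdsLE_iff_exists_Icc_subset.1 (hlim hU)
  have hm : max a l < b := max_lt hab hl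
  have hsub : Set.Icc (max a l) b ⊆ Set.Icc a b := Set.Icc_subset_Icc_left (le_max_left _ _)
  have hEq : Set.EqOn Φ (fun _ => Φ b) (Set.Icc (max a l) b) := by
    refine ODE_solution_unique_of_mem_Icc_left (v := fun _ => v) (s := fun _ => U) (K := K)
      (fun _ _ => hK) (hcont.mono hsub) (fun t ht => ?_)
      (fun t ht => hlU ⟨(le_max_right _ _).trans ht.1.le, ht.2⟩) continuousOn_const
      (fun t ht => ?_) (fun t _ => mem_of_mem_nhds hU) rfl
    · exact (hΦ t (hsub (Set.Ioc_subset_Icc_self ht))).mono_of_mem_nhdsWithin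
        (Icc_mem_nhdsLE_of_mem ⟨(le_max_left _ _).trans_lt ht.1, ht.2⟩)
    · have : v (Φ b) = 0 := by simp [v, Φ, hψ, heq]
      simpa only [this] using hasDerivWithinAt_const t (Set.Iic t) (Φ b)
  obtain ⟨t, ht1, ht2⟩ := exists_between hm
  refine ⟨t, (le_max_left _ _).trans_lt ht1, ht2, ?_⟩
  have := congrArg Prod.snd (hEq ⟨ht1.le, ht2.le⟩)
  exact this.trans hψ

/-- If `f < 0` to the left of `b` and `f b = 0`, then the left derivative at `b` is nonnegative. -/
lemma HasDerivWithinAt.nonneg_of_neg_left {f : ℝ → ℝ} {f' a b c : ℝ} (hac : a ≤ c) (hcb : c < b)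
    (hf : HasDerivWithinAt f f' (Set.Icc a b) b) (hb : f b = 0)
    (hneg : ∀ t, c < t → t < b → f t < 0) : 0 ≤ f' := by
  have hf' : HasDerivWithinAt f f' (Set.Ioo c b) b :=
    hf.mono fun t ht => ⟨hac.trans ht.1.le, ht.2.le⟩
  rw [hasDerivWithinAt_iff_tendsto_slope' (fun h => lt_irrefl _ h.2)] at hf'
  have : (nhdsWithin b (Set.Ioo c b)).NeBot := right_nhdsWithin_Ioo_neBot hcb
  refine ge_of_tendsto hf' (eventually_mem_nhdsWithin.mono fun t ht => ?_)
  rw [slope_def_field, hb, sub_zero]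
  exact div_nonneg_of_nonpos (hneg t ht.1 ht.2).le (sub_nonpos.2 ht.2.le)

lemma half_turns_spiral_inward {n p : ℕ} {lam b₀ b₁ b₂ : ℝ} {φ ψ : ℝ → ℝ}
    (hnp : (n : ℝ) = p + 1) (hp : 0 < p) (hlam : lam ≠ 0) (hs : 0 ≤ p - n / lam ^ 2)
    (hb01 : b₀ < b₁) (hb12 : b₁ < b₂)
    (hsol : ∀ t ∈ Set.Icc b₀ b₂, HasDerivWithinAt φ (ψ t) (Set.Icc b₀ b₂) t ∧
      HasDerivWithinAt ψ (X2 n p lam (φ t) (ψ t)) (Set.Icc b₀ b₂) t)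
    (h0 : 0 ≤ φ b₀) (hreg : 2 * ((p : ℝ) - 1) ≤ 3 * φ b₀ ^ 2)
    (hψb₀ : ψ b₀ = 0) (hψb₁ : ψ b₁ = 0) (hψb₂ : ψ b₂ = 0)
    (hpos : ∀ t : ℝ, b₀ < t → t < b₁ → 0 < ψ t)
    (hneg : ∀ t : ℝ, b₁ < t → t < b₂ → ψ t < 0) :
    Real.sqrt (p - n / lam ^ 2) < φ b₁ ∧ φ b₀ < φ b₂ ∧
      φ b₂ < Real.sqrt (p - n / lam ^ 2) := by
  have hVmono := strictMonoOn_potential hnp hlam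
  have hVanti := strictAntiOn_potential hnp hlam
  set φ₀ := Real.sqrt (p - n / lam ^ 2) with hφ₀
  have hcφ : ContinuousOn φ (Set.Icc b₀ b₂) := fun t ht => (hsol t ht).1.continuousWithinAt
  have hcψ : ContinuousOn ψ (Set.Icc b₀ b₂) := fun t ht => (hsol t ht).2.continuousWithinAt
  have hsol' : ∀ t ∈ Set.Ioo b₀ b₂,
      HasDerivAt φ (ψ t) t ∧ HasDerivAt ψ (X2 n p lam (φ t) (ψ t)) t := fun t ht =>
    have hnhds := Icc_mem_nhds ht.1 ht.2
    have h := hsol t (Set.Ioo_subset_Icc_self ht)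
    ⟨h.1.hasDerivAt hnhds, h.2.hasDerivAt hnhds⟩
  have hs01 : Set.Icc b₀ b₁ ⊆ Set.Icc b₀ b₂ := Set.Icc_subset_Icc_right hb12.le
  have hs12 : Set.Icc b₁ b₂ ⊆ Set.Icc b₀ b₂ := Set.Icc_subset_Icc_left hb01.le
  have hup : StrictMonoOn φ (Set.Icc b₀ b₁) := by
    refine strictMonoOn_of_deriv_pos (convex_Icc _ _) (hcφ.mono hs01) fun t ht => ?_
    rw [interior_Icc] at ht
    rw [(hsol' t ⟨ht.1, ht.2.trans hb12⟩).1.deriv]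
    exact hpos t ht.1 ht.2
  have hdown : StrictAntiOn φ (Set.Icc b₁ b₂) := by
    refine strictAntiOn_of_deriv_neg (convex_Icc _ _) (hcφ.mono hs12) fun t ht => ?_
    rw [interior_Icc] at ht
    rw [(hsol' t ⟨hb01.trans ht.1, ht.2⟩).1.deriv]
    exact hneg t ht.1 ht.2
  have hac : φ b₀ < φ b₁ :=
    hup (Set.left_mem_Icc.2 hb01.le) (Set.right_mem_Icc.2 hb01.le) hb01
  have hdc : φ b₂ < φ b₁ :=
    hdown (Set.left_mem_Icc.2 hb12.le) (Set.right_mem_Icc.2 hb12.le) hb12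
  have hreg' {x : ℝ} (hx : φ b₀ ≤ x) : 2 * ((p : ℝ) - 1) ≤ 3 * x ^ 2 := by
    nlinarith [pow_le_pow_left₀ h0 hx 2]
  have hE01 : -potential n p lam (φ b₁) < -potential n p lam (φ b₀) := by
    have := energy_lt_of_ne_zero hnp hp hlam hb01 (hcφ.mono hs01) (hcψ.mono hs01)
      (fun t ht => hsol' t ⟨ht.1, ht.2.trans hb12⟩)
      (fun t ht => hreg' (hup.monotoneOn (Set.left_mem_Icc.2 hb01.le)
        (Set.Ioo_subset_Icc_self ht) ht.1.le))
      (fun t ht => (hpos t ht.1 ht.2).ne')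
    rwa [hψb₀, hψb₁, energy_zero_right, energy_zero_right] at this
  have hE1 : ∀ t ∈ Set.Ioc b₁ b₂, φ b₀ ≤ φ t →
      -potential n p lam (φ t) < -potential n p lam (φ b₁) := by
    intro t ht hat
    have hst : Set.Icc b₁ t ⊆ Set.Icc b₁ b₂ := Set.Icc_subset_Icc_right ht.2
    have := energy_lt_of_ne_zero hnp hp hlam ht.1 (hcφ.mono (hst.trans hs12))
      (hcψ.mono (hst.trans hs12))
      (fun u hu => hsol' u ⟨hb01.trans hu.1, hu.2.trans_le ht.2⟩)
      (fun u hu => hreg' (hat.trans (hdown.antitoneOn (hst (Set.Ioo_subset_Icc_self hu))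
        (Set.Ioc_subset_Icc_self ht) hu.2.le)))
      (fun u hu => (hneg u hu.1 (hu.2.trans_le ht.2)).ne)
    rw [hψb₁, energy_zero_right] at this
    exact (neg_potential_le_energy n p lam _ _).trans_lt this
  have had : φ b₀ < φ b₂ := by
    by_contra! hda
    obtain ⟨t, ht, hta⟩ := intermediate_value_Icc' hb12.le (hcφ.mono hs12) ⟨hda, hac.le⟩
    have htb : b₁ < t := lt_of_le_of_ne ht.1 fun h => hac.ne (by rw [h, hta])
    have := hE1 t ⟨htb, ht.2⟩ hta.ge
    rw [hta] at this
    exact lt_asymm this hE01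
  have hc : φ₀ < φ b₁ := by
    by_contra! hc
    have h1 := hE1 b₂ ⟨hb12, le_rfl⟩ had.le
    have h2 := hVmono ⟨h0.trans had.le, hdc.le.trans hc⟩ ⟨h0.trans hac.le, hc⟩ hdc
    linarith
  refine ⟨hc, had, ?_⟩
  have hder : 0 ≤ X2 n p lam (φ b₂) (ψ b₂) :=
    (hsol b₂ (Set.right_mem_Icc.2 (hb01.trans hb12).le)).2.nonneg_of_neg_left
      hb01.le hb12 hψb₂ hneg
  have hX : X2 n p lam (φ b₂) 0 = f1 n p lam (φ b₂) * φ b₂ * (1 + φ b₂ ^ 2) := by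
    rw [X2]; ring
  by_contra! hd
  rcases hd.eq_or_lt with hd | hd
  · have hsq : φ b₂ ^ 2 = p - n / lam ^ 2 := by rw [← hd, hφ₀, Real.sq_sqrt hs]
    obtain ⟨t, ht1, ht2, ht⟩ := exists_eq_zero_of_equilibrium hb12
      (fun t ht => ⟨(hsol t (hs12 ht)).1.mono hs12, (hsol t (hs12 ht)).2.mono hs12⟩) hψb₂
      (by rw [hX, f1_eq_zero hnp hlam hsq, zero_mul, zero_mul])
    exact (hneg t ht1 ht2).ne ht
  · have hd0 : 0 < φ b₂ := h0.trans_lt had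
    have := f1_neg hnp hlam ((Real.sqrt_lt' hd0).1 hd)
    rw [hψb₂, hX] at hder
    exact hder.not_gt (mul_neg_of_neg_of_pos (mul_neg_of_neg_of_pos this hd0) (by positivity))

/-- Lemma A.1 of Appendix A.4 of Xu–Yang–Zhang: for a solution of (ODE2) on
`[b₀,b₂]` with the stated sign pattern of `ψ` and `φ(b₀) ≥ √((3p-n-1)/(3(n-p)))`,
one has `φ(b₁) > φ₀` and `φ(b₀) < φ(b₂) < φ₀`; in particular (second conjunct)
there is no nonconstant periodic orbit of (ODE2) contained in the region
`φ ≥ √((3p-n-1)/(3(n-p)))`. -/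
theorem ode2_no_limit_cycle (n p k : ℕ)
    (h : ((n, p) = (3, 2) ∧ 4 ≤ k) ∨ ((n, p) = (5, 4) ∧ 6 ≤ k))
    (lam φ₀ : ℝ)
    (hlam : lam = Real.sqrt ((k : ℝ) * ((k : ℝ) + n - 1) / p))
    (hφ₀ : φ₀ = Real.sqrt (((p : ℝ) - n / lam ^ 2) / ((n : ℝ) - p)))
    (b₀ b₁ b₂ : ℝ) (hb01 : b₀ < b₁) (hb12 : b₁ < b₂)
    (φ ψ : ℝ → ℝ)
    (hsol : ∀ t ∈ Set.Icc b₀ b₂,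
      HasDerivWithinAt φ (ψ t) (Set.Icc b₀ b₂) t ∧
      HasDerivWithinAt ψ (X2 n p lam (φ t) (ψ t)) (Set.Icc b₀ b₂) t)
    (hφb₀ : Real.sqrt ((3 * (p : ℝ) - n - 1) / (3 * ((n : ℝ) - p))) ≤ φ b₀)
    (hψb₀ : ψ b₀ = 0) (hψb₁ : ψ b₁ = 0) (hψb₂ : ψ b₂ = 0)
    (hpos : ∀ t : ℝ, b₀ < t → t < b₁ → 0 < ψ t)
    (hneg : ∀ t : ℝ, b₁ < t → t < b₂ → ψ t < 0) :
    (φ₀ < φ b₁ ∧ φ b₀ < φ b₂ ∧ φ b₂ < φ₀) ∧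
    (∀ φ' ψ' : ℝ → ℝ,
      (∀ t : ℝ, HasDerivAt φ' (ψ' t) t ∧
        HasDerivAt ψ' (X2 n p lam (φ' t) (ψ' t)) t) →
      (∀ t : ℝ, Real.sqrt ((3 * (p : ℝ) - n - 1) / (3 * ((n : ℝ) - p))) ≤ φ' t) →
      ∀ c : ℝ, 0 < c → (∀ t : ℝ, φ' (t + c) = φ' t ∧ ψ' (t + c) = ψ' t) →
      ∀ s t : ℝ, φ' s = φ' t ∧ ψ' s = ψ' t) := by
  have hnp : (n : ℝ) = p + 1 := by
    rcases h with ⟨h, -⟩ | ⟨h, -⟩ <;> obtain ⟨rfl, rfl⟩ := Prod.mk.inj h <;> norm_num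
  have hp : 0 < p := by
    rcases h with ⟨h, -⟩ | ⟨h, -⟩ <;> obtain ⟨rfl, rfl⟩ := Prod.mk.inj h <;> norm_num
  have hsq : (4 : ℝ) ≤ lam ^ 2 := by
    rw [hlam, Real.sq_sqrt (by rw [hnp, add_sub_assoc, add_sub_cancel_right]; positivity)]
    rcases h with ⟨h, hk⟩ | ⟨h, hk⟩ <;> obtain ⟨rfl, rfl⟩ := Prod.mk.inj h
    · have : (4 : ℝ) ≤ k := by exact_mod_cast hk
      push_cast
      nlinarith
    · have : (6 : ℝ) ≤ k := by exact_mod_cast hk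
      push_cast
      nlinarith
  have hlam0 : lam ≠ 0 := by
    rintro rfl
    norm_num at hsq
  have hp1 : (1 : ℝ) ≤ p := by exact_mod_cast hp
  have hs : 0 ≤ (p : ℝ) - n / lam ^ 2 := by
    rw [sub_nonneg, div_le_iff₀ (by linarith), hnp]
    nlinarith
  have hsub : (n : ℝ) - p = 1 := by rw [hnp]; ring
  have hθ {x : ℝ} (hx : Real.sqrt ((3 * (p : ℝ) - n - 1) / (3 * ((n : ℝ) - p))) ≤ x) :
      0 ≤ x ∧ 2 * ((p : ℝ) - 1) ≤ 3 * x ^ 2 := by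
    have hx0 := (Real.sqrt_nonneg _).trans hx
    rw [Real.sqrt_le_left hx0, hsub, div_le_iff₀ (by norm_num)] at hx
    exact ⟨hx0, by linarith⟩
  rw [hsub, div_one] at hφ₀
  subst hφ₀
  exact ⟨half_turns_spiral_inward hnp hp hlam0 hs hb01 hb12 hsol (hθ hφb₀).1 (hθ hφb₀).2
    hψb₀ hψb₁ hψb₂ hpos hneg, fun φ' ψ' hsol' hreg c hc hper =>
    eq_of_periodic_of_damping hnp hp hlam0 hsol' (fun t => (hθ (hreg t)).2) hc hper⟩
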